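/- Let a < b, q ≥ 0, and let u : [a,b] → [m₁, m₂] be a q-concave function with u(a) = u(b) =: H ≥ u(x) for all x ∈ [a,b]. Then ∫_a^b dx/(1+u'(x)²) ≥ ∫_a^b dx/(1 + q²(x − (a+b)/2)²), i.e., the resistance of u is at least that of the parabola x ↦ (q/2)(x−a)(x−b) + H, with equality if and only if u equals this parabola. -/

import Mathlib

open MeasureTheory Set Filter

/-- a.e. differentiability and subgradients of a convex function on an interval -/
lemma pc_subgrad (a b : ℝ) (h : ℝ → ℝ) (hc : ConvexOn ℝ (Icc a b) h) :
    ∃ k : ℝ → ℝ, (∀ x ∈ Ioo a b, ∀ y ∈ Icc a b, h x + k x * (y - x) ≤ h y) ∧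
      ∀ᵐ x : ℝ, x ∈ Ioo a b → HasDerivAt h (k x) x := by
  refine ⟨fun x => derivWithin h (Ioi x) x, ?_, ?_⟩
  · intro x hx y hy
    have hxi : x ∈ interior (Icc a b) := by rwa [interior_Icc]
    rcases lt_trichotomy x y with hxy | hxy | hxy
    · have := hc.rightDeriv_le_slope_of_mem_interior hxi hy hxy
      rw [slope_def_field, le_div_iff₀ (by linarith)] at this
      linarith
    · subst hxy; simp
    · have h1 := hc.slope_le_leftDeriv_of_mem_interior hy hxi hxy
      have h2 := hc.leftDeriv_le_rightDeriv_of_mem_interior hxi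
      have := h1.trans h2
      rw [slope_def_field, div_le_iff₀ (by linarith)] at this
      linarith
  · have hll := hc.locallyLipschitzOn_interior
    rw [interior_Icc] at hll
    have key : ∀ n : ℕ, ∀ᵐ x : ℝ, x ∈ Icc (a + 1/((n:ℝ)+1)) (b - 1/((n:ℝ)+1)) →
        DifferentiableWithinAt ℝ h (Icc (a + 1/((n:ℝ)+1)) (b - 1/((n:ℝ)+1))) x := by
      intro n
      have hpos : 0 < 1/((n:ℝ)+1) := by positivity
      have hsub : Icc (a + 1/((n:ℝ)+1)) (b - 1/((n:ℝ)+1)) ⊆ Ioo a b := by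
        intro x hx; exact ⟨by linarith [hx.1], by linarith [hx.2]⟩
      obtain ⟨K, hK⟩ := (hll.mono hsub).exists_lipschitzOnWith_of_compact isCompact_Icc
      exact hK.ae_differentiableWithinAt_of_mem
    filter_upwards [ae_all_iff.2 key] with x hx hxab
    obtain ⟨n, hn⟩ := exists_nat_one_div_lt (lt_min (sub_pos.2 hxab.1) (sub_pos.2 hxab.2))
    have h1 := lt_of_lt_of_le hn (min_le_left _ _)
    have h2 := lt_of_lt_of_le hn (min_le_right _ _)
    have hd := (hx n ⟨by linarith, by linarith⟩).differentiableAt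
      (Icc_mem_nhds (by linarith) (by linarith))
    have := hd.hasDerivAt
    rwa [← this.hasDerivWithinAt.derivWithin (uniqueDiffWithinAt_Ioi x)] at this

lemma pc_level_pos (a b q t : ℝ) (g : ℝ → ℝ)
    (hs : ∀ x ∈ Ioo a b, ∀ y ∈ Ioo a b, x < y → g y - g x ≤ q * (y - x))
    (hu : ∀ x ∈ Ioo a b, g x ≤ q * (x - a) / 2) (hq : 0 < q) (ht : 0 < t)
    (hex : ∃ x ∈ Ioo a b, t ≤ g x) :
    ∃ x0 x1, a ≤ x0 ∧ x1 ≤ b ∧ 2 * t ≤ q * (x1 - x0) ∧ ∀ x ∈ Ioo x0 x1, |g x| < t := by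
  set A : Set ℝ := {x | x ∈ Ioo a b ∧ t ≤ g x} with hA
  obtain ⟨z, hz, hzt⟩ := hex
  have hAne : A.Nonempty := ⟨z, hz, hzt⟩
  have hAb : BddBelow A := ⟨a, fun x hx => hx.1.1.le⟩
  set x1 := sInf A with hx1
  have hx1b : x1 ≤ b := (csInf_le hAb ⟨hz, hzt⟩).trans hz.2.le
  set B : Set ℝ := {x | x = a ∨ (x ∈ Ioo a x1 ∧ g x ≤ -t)} with hB
  have hBne : B.Nonempty := ⟨a, Or.inl rfl⟩
  have hAB : ∀ x ∈ B, ∀ y ∈ A, x + 2 * t / q ≤ y := by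
    intro x hx y hy
    have : 2 * t ≤ q * (y - x) := by
      rcases hx with rfl | ⟨hx, hgx⟩
      · have := hu y hy.1
        have := hy.2
        linarith
      · have h1 : x1 ≤ y := csInf_le hAb hy
        have := hs x ⟨hx.1, by linarith [hx.2]⟩ y hy.1 (by linarith [hx.2])
        have := hy.2
        linarith
    have : 2 * t / q ≤ y - x := by rw [div_le_iff₀ hq]; linarith
    linarith
  have hB1 : ∀ x ∈ B, x + 2 * t / q ≤ x1 := fun x hx => le_csInf hAne (hAB x hx)
  have hBb : BddAbove B := ⟨x1 - 2 * t / q, fun x hx => by linarith [hB1 x hx]⟩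
  have h01 : sSup B ≤ x1 - 2 * t / q := csSup_le hBne fun x hx => by linarith [hB1 x hx]
  have ha0 : a ≤ sSup B := le_csSup hBb (Or.inl rfl)
  refine ⟨sSup B, x1, ha0, hx1b, ?_, ?_⟩
  · have : 2 * t / q ≤ x1 - sSup B := by linarith
    rw [div_le_iff₀ hq] at this; linarith
  · intro x hx
    rw [abs_lt]
    constructor
    · by_contra hcon
      have := le_csSup hBb (show x ∈ B from Or.inr ⟨⟨by linarith [hx.1], hx.2⟩, by linarith⟩)
      linarith [hx.1]
    · by_contra hcon
      have := csInf_le hAb (show x ∈ A from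
        ⟨⟨by linarith [hx.1], by linarith [hx.2]⟩, by linarith⟩)
      linarith [hx.2]

lemma pc_level (a b q t : ℝ) (g : ℝ → ℝ)
    (hs : ∀ x ∈ Ioo a b, ∀ y ∈ Ioo a b, x < y → g y - g x ≤ q * (y - x))
    (hu : ∀ x ∈ Ioo a b, g x ≤ q * (x - a) / 2)
    (hl : ∀ x ∈ Ioo a b, -(q * (b - x) / 2) ≤ g x) (hq : 0 ≤ q) (ht : 0 < t) :
    (∀ x ∈ Ioo a b, |g x| < t) ∨ (0 < q ∧ 
    ∃ x0 x1, a ≤ x0 ∧ x1 ≤ b ∧ 2 * t ≤ q * (x1 - x0) ∧ ∀ x ∈ Ioo x0 x1, |g x| < t) := by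
  rcases hq.eq_or_lt with rfl | hq
  · left
    intro x hx
    have h1 := hu x hx
    have h2 := hl x hx
    rw [abs_lt]; constructor <;> linarith
  by_cases h1 : ∃ x ∈ Ioo a b, t ≤ g x
  · exact Or.inr ⟨hq, pc_level_pos a b q t g hs hu hq ht h1⟩
  by_cases h2 : ∃ x ∈ Ioo a b, g x ≤ -t
  · right
    refine ⟨hq, ?_⟩
    have hr : ∀ x ∈ Ioo a b, a + b - x ∈ Ioo a b := fun x hx =>
      ⟨by linarith [hx.2], by linarith [hx.1]⟩
    obtain ⟨x0, x1, h0, h1, h01, h⟩ := pc_level_pos a b q t (fun x => - g (a + b - x))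
      (fun x hx y hy hxy => by
        have := hs _ (hr y hy) _ (hr x hx) (by linarith)
        linarith)
      (fun x hx => by
        have := hl _ (hr x hx)
        rw [show b - (a + b - x) = x - a by ring] at this
        linarith) hq ht
      (by
        obtain ⟨z, hz, hzt⟩ := h2
        refine ⟨a + b - z, hr z hz, ?_⟩
        rw [show a + b - (a + b - z) = z by ring]
        linarith)
    refine ⟨a + b - x1, a + b - x0, by linarith, by linarith, by linarith, ?_⟩
    intro x hx
    have := h (a + b - x) ⟨by linarith [hx.2], by linarith [hx.1]⟩
    rwa [show a + b - (a + b - x) = x by ring, abs_neg] at this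
  · left
    push Not at h1 h2
    intro x hx
    rw [abs_lt]
    exact ⟨h2 x hx, h1 x hx⟩

lemma pc_upper (a b q H z : ℝ) (u g : ℝ → ℝ) (hq : 0 < q)
    (hstar : ∀ x ∈ Ioo a b, ∀ y ∈ Icc a b, u y ≤ u x + g x * (y - x) + q / 2 * (y - x) ^ 2)
    (hu : ∀ x ∈ Ioo a b, g x ≤ q * (x - a) / 2)
    (hH : ∀ x ∈ Ioo a b, u x ≤ H) (hz : z ∈ Ioo a b)
    (hzp : q / 2 * (z - a) * (z - b) + H < u z) :
    ∃ M, M < q * (b - a) / 2 ∧ ∀ x ∈ Ioo a b, g x ≤ M := by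
  obtain ⟨hza, hzb⟩ := hz
  have hc : 0 < q / 2 * (z - a) := by have := sub_pos.2 hza; positivity
  have hA0 : 0 ≤ H - u z := by linarith [hH z ⟨hza, hzb⟩]
  have hlt : z + (H - u z) / (q / 2 * (z - a)) < b := by
    have : (H - u z) / (q / 2 * (z - a)) < b - z := by
      rw [div_lt_iff₀ hc]; linarith
    linarith
  obtain ⟨r, hr1, hr2⟩ := exists_between hlt
  have hzr : z < r := by
    have : 0 ≤ (H - u z) / (q / 2 * (z - a)) := by positivity
    linarith
  have hA : (H - u z) / (r - z) < q / 2 * (z - a) := by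
    have : (H - u z) / (q / 2 * (z - a)) < r - z := by linarith
    rw [div_lt_iff₀ hc] at this
    rw [div_lt_iff₀ (by linarith)]; linarith
  refine ⟨max (q * (r - a) / 2) ((H - u z) / (r - z) + q / 2 * (b - z)), ?_, ?_⟩
  · apply max_lt
    · have := mul_lt_mul_of_pos_left hr2 hq
      linarith
    · linarith
  · intro x hx
    rcases le_total x r with hxr | hxr
    · apply le_max_of_le_left
      have := hu x hx
      have := mul_le_mul_of_nonneg_left hxr hq.le
      linarith
    · apply le_max_of_le_right
      have h1 := hstar x hx z ⟨hza.le, hzb.le⟩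
      have h2 := hH x hx
      have hp : 0 < x - z := by linarith
      have h3 : g x ≤ (H - u z) / (x - z) + q / 2 * (x - z) := by
        have : g x - q / 2 * (x - z) ≤ (H - u z) / (x - z) := by
          rw [le_div_iff₀ hp]; linarith
        linarith
      have h4 : (H - u z) / (x - z) ≤ (H - u z) / (r - z) :=
        div_le_div_of_nonneg_left hA0 (by linarith) (by linarith)
      have h5 := mul_le_mul_of_nonneg_left hx.2.le hq.le
      linarith

lemma pc_layer (a b : ℝ) (f1 f2 : ℝ → ℝ) (hab : a < b)
    (m1 : Measurable f1) (m2 : Measurable f2)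
    (p1 : ∀ x, 0 ≤ f1 x) (p2 : ∀ x, 0 ≤ f2 x) (l1 : ∀ x, f1 x ≤ 1) (l2 : ∀ x, f2 x ≤ 1)
    (hm : ∀ s, 0 < s → s < 1 → volume.restrict (Ioo a b) {x | s < f1 x}
      ≤ volume.restrict (Ioo a b) {x | s < f2 x}) :
    (∫ x in a..b, f1 x) ≤ (∫ x in a..b, f2 x) ∧
    ((∃ s1 s2, 0 < s1 ∧ s1 < s2 ∧ ∀ s ∈ Ioo s1 s2, volume.restrict (Ioo a b) {x | s < f1 x}
      ≠ volume.restrict (Ioo a b) {x | s < f2 x}) →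
      (∫ x in a..b, f1 x) < (∫ x in a..b, f2 x)) := by
  set μ := volume.restrict (Ioo a b) with hμ
  have hI : ∀ f : ℝ → ℝ, Measurable f → (∀ x, 0 ≤ f x) → (∫ x in a..b, f x)
      = (∫⁻ s in Ioi (0:ℝ), μ {x | s < f x}).toReal := by
    intro f hf hp
    rw [intervalIntegral.integral_of_le hab.le, ← restrict_Ioo_eq_restrict_Ioc,
      integral_eq_lintegral_of_nonneg_ae (Eventually.of_forall hp) hf.aestronglyMeasurable,
      lintegral_eq_lintegral_meas_lt _ (Eventually.of_forall hp) hf.aemeasurable]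
  have hF : ∀ f : ℝ → ℝ, Measurable f → (∀ x, 0 ≤ f x) → (∀ x, f x ≤ 1) →
      (∫⁻ s in Ioi (0:ℝ), μ {x | s < f x}) ≠ ⊤ := by
    intro f hf hp hl
    rw [← lintegral_eq_lintegral_meas_lt _ (Eventually.of_forall hp) hf.aemeasurable]
    have : ∫⁻ x, ENNReal.ofReal (f x) ∂μ ≤ ∫⁻ x, 1 ∂μ := by
      apply lintegral_mono
      intro x
      simpa using hl x
    refine ne_top_of_le_ne_top ?_ this
    simp [hμ]
  have hle : (fun s => μ {x | s < f1 x}) ≤ᵐ[volume.restrict (Ioi (0:ℝ))]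
      (fun s => μ {x | s < f2 x}) := by
    filter_upwards [ae_restrict_mem measurableSet_Ioi] with s hs
    rcases lt_or_ge s 1 with h | h
    · exact hm s hs h
    · have : {x | s < f1 x} = ∅ := by
        ext x; simp; linarith [l1 x]
      rw [this]; simp
  rw [hI f1 m1 p1, hI f2 m2 p2]
  refine ⟨ENNReal.toReal_mono (hF f2 m2 p2 l2) (lintegral_mono_ae hle), ?_⟩
  rintro ⟨s1, s2, h0, h12, hne⟩
  rw [ENNReal.toReal_lt_toReal (hF f1 m1 p1 l1) (hF f2 m2 p2 l2)]
  refine lintegral_strict_mono_of_ae_le_of_ae_lt_on ?_ (hF f1 m1 p1 l1) hle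
    (s := Ioo s1 s2) ?_ ?_
  · apply Measurable.aemeasurable
    apply Antitone.measurable
    intro s s' hss
    exact measure_mono fun x hx => lt_of_le_of_lt hss hx
  · rw [Measure.restrict_apply measurableSet_Ioo,
      inter_eq_left.2 (show Ioo s1 s2 ⊆ Ioi 0 from fun x hx => h0.trans hx.1)]
    simp [h12]
  · filter_upwards [hle] with s hs hss
    exact lt_of_le_of_ne hs (hne s hss)

lemma pc_lt_iff (s p : ℝ) (hs : 0 < s) (hs1 : s < 1) :
    s < 1 / (1 + p ^ 2) ↔ |p| < Real.sqrt (1 / s - 1) := by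
  have h1 : 0 < 1 / s - 1 := by
    rw [sub_pos, lt_div_iff₀ hs]; linarith
  rw [Real.lt_sqrt (abs_nonneg p), sq_abs, lt_div_iff₀ (by positivity), lt_sub_iff_add_lt,
    lt_div_iff₀ hs]
  constructor <;> intro h <;> linarith

theorem parabola_optimal_center (a b q m₁ m₂ : ℝ) (hab : a < b) (hq : 0 ≤ q)
    (u : ℝ → ℝ)
    (hconc : ConcaveOn ℝ (Set.Icc a b) (fun x => u x - q / 2 * x^2))
    (hrange : ∀ x ∈ Set.Icc a b, u x ∈ Set.Icc m₁ m₂)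
    (hend : u a = u b) (hmax : ∀ x ∈ Set.Icc a b, u x ≤ u a) :
    (∫ x in a..b, 1 / (1 + q^2 * (x - (a + b) / 2)^2)) ≤
        (∫ x in a..b, 1 / (1 + deriv u x ^ 2)) ∧
      ((∫ x in a..b, 1 / (1 + deriv u x ^ 2)) =
          (∫ x in a..b, 1 / (1 + q^2 * (x - (a + b) / 2)^2)) ↔
        Set.EqOn u (fun x => q / 2 * (x - a) * (x - b) + u a)
          (Set.Icc a b)) := by
  obtain ⟨k, hk, hkd⟩ := pc_subgrad a b _ hconc.neg
  set g : ℝ → ℝ := fun x => q * x - k x with hg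
  have hstar : ∀ x ∈ Ioo a b, ∀ y ∈ Icc a b,
      u y ≤ u x + g x * (y - x) + q / 2 * (y - x) ^ 2 := by
    intro x hx y hy
    have := hk x hx y hy
    simp only [Pi.neg_apply] at this
    simp only [hg]
    linarith
  have hgd : ∀ᵐ x : ℝ, x ∈ Ioo a b → deriv u x = g x := by
    filter_upwards [hkd] with x hx hxab
    have h1 := (hx hxab).neg.add (((hasDerivAt_id x).pow 2).const_mul (q / 2))
    have h2 : HasDerivAt u (g x) x := by
      have h3 : u = ((- -fun x => u x - q / 2 * x ^ 2) + fun y => q / 2 * (id ^ 2 : ℝ → ℝ) y) := by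
        ext y; simp
      rw [h3]
      refine h1.congr_deriv ?_
      simp [hg]; ring
    exact h2.deriv
  have hmem : ∀ x ∈ Ioo a b, x ∈ Icc a b := fun x hx => Ioo_subset_Icc_self hx
  have hgu : ∀ x ∈ Ioo a b, g x ≤ q * (x - a) / 2 := by
    intro x hx
    have h1 := hstar x hx a ⟨le_rfl, hab.le⟩
    have h2 := hmax x (hmem x hx)
    have hp : 0 < x - a := sub_pos.2 hx.1
    have : g x * (x - a) ≤ (q * (x - a) / 2) * (x - a) := by linarith
    exact le_of_mul_le_mul_right this hp
  have hgl : ∀ x ∈ Ioo a b, -(q * (b - x) / 2) ≤ g x := by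
    intro x hx
    have h1 := hstar x hx b ⟨hab.le, le_rfl⟩
    have h2 := hmax x (hmem x hx)
    have hp : 0 < b - x := sub_pos.2 hx.2
    have : -(q * (b - x) / 2) * (b - x) ≤ g x * (b - x) := by linarith
    exact le_of_mul_le_mul_right this hp
  have hgs : ∀ x ∈ Ioo a b, ∀ y ∈ Ioo a b, x < y → g y - g x ≤ q * (y - x) := by
    intro x hx y hy hxy
    have h1 := hstar x hx y (hmem y hy)
    have h2 := hstar y hy x (hmem x hx)
    have hp : 0 < y - x := sub_pos.2 hxy
    have : (g y - g x) * (y - x) ≤ (q * (y - x)) * (y - x) := by linarith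
    exact le_of_mul_le_mul_right this hp
  set c := (a + b) / 2 with hc
  set f1 : ℝ → ℝ := fun x => 1 / (1 + (q * (x - c)) ^ 2) with hf1
  set f2 : ℝ → ℝ := fun x => 1 / (1 + deriv u x ^ 2) with hf2
  have hf1' : (∫ x in a..b, 1 / (1 + q ^ 2 * (x - c) ^ 2)) = ∫ x in a..b, f1 x := by
    simp only [hf1, mul_pow]
  rw [hf1']
  have hp : ∀ p : ℝ, 0 ≤ 1 / (1 + p ^ 2) := fun p => by positivity
  have hl : ∀ p : ℝ, 1 / (1 + p ^ 2) ≤ 1 := fun p => by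
    rw [div_le_one (by positivity)]; nlinarith [sq_nonneg p]
  have m1 : Measurable f1 := by simp only [hf1]; fun_prop
  have m2 : Measurable f2 := by
    have := measurable_deriv u
    simp only [hf2]; fun_prop
  -- lower bound of the measure of level sets of f2
  have hlow : ∀ s, 0 < s → s < 1 → ∀ S : Set ℝ, MeasurableSet S → S ⊆ Ioo a b →
      (∀ x ∈ S, |g x| < Real.sqrt (1 / s - 1)) →
      volume S ≤ volume.restrict (Ioo a b) {x | s < f2 x} := by
    intro s hs hs1 S hSm hS hSg
    rw [← inter_eq_left.2 hS, ← Measure.restrict_apply hSm]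
    apply measure_mono_ae
    have hgd' := (ae_restrict_iff' (μ := volume) (measurableSet_Ioo (a := a) (b := b))).2 hgd
    filter_upwards [hgd'] with x hx hxS
    change s < 1 / (1 + deriv u x ^ 2)
    rw [pc_lt_iff s _ hs hs1, hx]
    exact hSg x hxS
  -- upper bound for f1
  have hup : ∀ s, 0 < s → s < 1 → 0 < q →
      volume {x | s < f1 x} ≤ ENNReal.ofReal (2 * Real.sqrt (1 / s - 1) / q) := by
    intro s hs hs1 hq0
    set t := Real.sqrt (1 / s - 1)
    have : {x | s < f1 x} ⊆ Ioo (c - t / q) (c + t / q) := by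
      intro x hx
      have hx : s < 1 / (1 + (q * (x - c)) ^ 2) := hx
      rw [pc_lt_iff s _ hs hs1, abs_mul, abs_of_pos hq0, mul_comm, ← lt_div_iff₀ hq0,
        abs_lt] at hx
      exact ⟨by linarith [hx.1], by linarith [hx.2]⟩
    refine (measure_mono this).trans ?_
    rw [Real.volume_Ioo]
    apply ENNReal.ofReal_le_ofReal
    apply le_of_eq
    ring
  have hmain := pc_layer a b f1 f2 hab m1 m2 (fun x => hp _) (fun x => hp _)
    (fun x => hl _) (fun x => hl _) (by
      intro s hs hs1
      have ht : 0 < Real.sqrt (1 / s - 1) := by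
        rw [Real.sqrt_pos, sub_pos, lt_div_iff₀ hs]; linarith
      rcases pc_level a b q _ g hgs hgu hgl hq ht with h | ⟨hq0, x0, x1, h0, h1, h01, h⟩
      · refine le_trans ?_ (hlow s hs hs1 (Ioo a b) measurableSet_Ioo le_rfl h)
        refine (measure_mono (subset_univ _)).trans ?_
        simp
      · refine le_trans ?_ (hlow s hs hs1 (Ioo x0 x1) measurableSet_Ioo
          (Ioo_subset_Ioo h0 h1) h)
        refine (Measure.restrict_apply_le _ _).trans ((hup s hs hs1 hq0).trans ?_)
        rw [Real.volume_Ioo]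
        apply ENNReal.ofReal_le_ofReal
        rw [div_le_iff₀ hq0]; linarith)
  refine ⟨hmain.1, ?_, ?_⟩
  · intro heq
    by_contra hne
    apply absurd heq
    apply ne_of_gt
    apply hmain.2
    -- there is a point strictly above the parabola
    have hge : ∀ x ∈ Ioo a b, q / 2 * (x - a) * (x - b) + u a ≤ u x := by
      intro x hx
      have h1 := mul_le_mul_of_nonneg_left (hstar x hx a ⟨le_rfl, hab.le⟩)
        (sub_nonneg.2 hx.2.le)
      have h2 := mul_le_mul_of_nonneg_left (hstar x hx b ⟨hab.le, le_rfl⟩)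
        (sub_nonneg.2 hx.1.le)
      rw [← hend] at h2
      have : (q / 2 * (x - a) * (x - b) + u a) * (b - a) ≤ u x * (b - a) := by linarith
      exact le_of_mul_le_mul_right this (sub_pos.2 hab)
    have hex : ∃ z ∈ Ioo a b, q / 2 * (z - a) * (z - b) + u a < u z := by
      by_contra hcon
      push Not at hcon
      apply hne
      intro x hx
      rcases hx.1.eq_or_lt with rfl | hxa
      · simp
      rcases hx.2.eq_or_lt with rfl | hxb
      · simp [hend]
      exact le_antisymm (hcon x ⟨hxa, hxb⟩) (hge x ⟨hxa, hxb⟩)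
    obtain ⟨z, hz, hzp⟩ := hex
    have hq0 : 0 < q := by
      rcases hq.eq_or_lt with rfl | h
      · have := hmax z (hmem z hz)
        simp at hzp; linarith
      · exact h
    have hr : ∀ x ∈ Ioo a b, a + b - x ∈ Ioo a b := fun x hx =>
      ⟨by linarith [hx.2], by linarith [hx.1]⟩
    obtain ⟨M1, hM1, hM1'⟩ := pc_upper a b q (u a) z u g hq0 hstar hgu
      (fun x hx => hmax x (hmem x hx)) hz hzp
    obtain ⟨M2, hM2, hM2'⟩ := pc_upper a b q (u a) (a + b - z) (fun x => u (a + b - x))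
      (fun x => - g (a + b - x)) hq0
      (fun x hx y hy => by
        have := hstar _ (hr x hx) (a + b - y) ⟨by linarith [hy.2], by linarith [hy.1]⟩
        linarith)
      (fun x hx => by
        have := hgl _ (hr x hx)
        rw [show b - (a + b - x) = x - a by ring] at this
        linarith)
      (fun x hx => hmax _ (hmem _ (hr x hx))) (hr z hz) (by
        rw [show a + b - (a + b - z) = z by ring]
        linarith)
    have hT : 0 < q * (b - a) / 2 := by have := sub_pos.2 hab; positivity
    set T := q * (b - a) / 2 with hTdef
    set M := max 0 (max M1 M2) with hM
    have hMT : M < T := max_lt hT (max_lt hM1 hM2)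
    have hM0 : 0 ≤ M := le_max_left _ _
    have hgM : ∀ x ∈ Ioo a b, |g x| ≤ M := by
      intro x hx
      rw [abs_le]
      have h1 := hM1' x hx
      have h2 := hM2' _ (hr x hx)
      rw [show a + b - (a + b - x) = x by ring] at h2
      have h3 : M1 ≤ M := (le_max_left _ _).trans (le_max_right _ _)
      have h4 : M2 ≤ M := (le_max_right _ _).trans (le_max_right _ _)
      constructor <;> linarith
    refine ⟨1 / (1 + T ^ 2), 1 / (1 + M ^ 2), by positivity, ?_, ?_⟩
    · apply one_div_lt_one_div_of_lt (by positivity)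
      nlinarith
    · rintro s ⟨hs1, hs2⟩
      have hs0 : 0 < s := lt_trans (by positivity) hs1
      have hs3 : s < 1 := hs2.trans_le (hl M)
      have hMt := (pc_lt_iff s M hs0 hs3).1 hs2
      have htT : Real.sqrt (1 / s - 1) < T := by
        rw [Real.sqrt_lt' hT]
        rw [div_lt_iff₀ (by positivity)] at hs1
        rw [sub_lt_iff_lt_add, div_lt_iff₀ hs0]; linarith
      rw [abs_of_nonneg hM0] at hMt
      apply ne_of_lt
      refine lt_of_lt_of_le ?_ (hlow s hs0 hs3 (Ioo a b) measurableSet_Ioo le_rfl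
        (fun x hx => (hgM x hx).trans_lt hMt))
      refine lt_of_le_of_lt ((Measure.restrict_apply_le _ _).trans (hup s hs0 hs3 hq0)) ?_
      rw [Real.volume_Ioo, ENNReal.ofReal_lt_ofReal_iff (sub_pos.2 hab), div_lt_iff₀ hq0]
      linarith
  · intro heq
    rw [intervalIntegral.integral_of_le hab.le, intervalIntegral.integral_of_le hab.le,
      ← restrict_Ioo_eq_restrict_Ioc]
    apply setIntegral_congr_fun measurableSet_Ioo
    intro x hx
    have hev : u =ᶠ[nhds x] (fun x => q / 2 * (x - a) * (x - b) + u a) := by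
      filter_upwards [Ioo_mem_nhds hx.1 hx.2] with y hy
      exact heq (hmem y hy)
    have hd : HasDerivAt (fun x => q / 2 * (x - a) * (x - b) + u a) (q * (x - c)) x := by
      have h1 := ((((hasDerivAt_id x).sub_const a).const_mul (q / 2)).mul
        ((hasDerivAt_id x).sub_const b)).add_const (u a)
      refine h1.congr_deriv ?_
      simp [hc]; ring
    change 1 / (1 + deriv u x ^ 2) = 1 / (1 + (q * (x - c)) ^ 2)
    rw [hev.deriv_eq, hd.deriv]
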